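/- Let p, q : ℝ² → ℂ be smooth functions with compact support contained in ℝ² ∖ {0}. Define f(x) = ∫_{ℝ²} p(k) exp(i(k₁x₁ + k₂x₂) + ‖k‖x₃) dk/((2π)² · 2‖k‖) and g(x) = ∫_{ℝ²} q(k) exp(i(k₁x₁ + k₂x₂) − ‖k‖x₃) dk/((2π)² · 2‖k‖) for x = (x₁,x₂,x₃) ∈ ℝ³. Then the function (x₁,x₂) ↦ (g ∂₃f − f ∂₃g)(x₁,x₂,0) is integrable on ℝ² and ∫_{ℝ²} (g ∂₃f − f ∂₃g)(x₁,x₂,0) dx₁dx₂ = ∫_{ℝ²} p(k) q(−k) dk/((2π)² · 2‖k‖). -/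

import Mathlib

open MeasureTheory Real

noncomputable section

/-- `ℝ³` with the Euclidean norm. -/
abbrev E3 : Type := EuclideanSpace ℝ (Fin 3)

/-- `ℝ²` with the Euclidean norm. -/
abbrev E2 : Type := EuclideanSpace ℝ (Fin 2)

/-- Points of `ℝ³` from three coordinates. -/
def mk3 (a b c : ℝ) : E3 := (WithLp.equiv 2 (Fin 3 → ℝ)).symm ![a, b, c]

/-- Partial derivative `∂ᵢ` of a complex-valued function on `ℝ³`. -/
def pd (i : Fin 3) (f : E3 → ℂ) : E3 → ℂ :=
  fun x => fderiv ℝ f x (EuclideanSpace.single i 1)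

/-- `f(x) = ∫_{ℝ²} p(k) exp(i(k₁x₁+k₂x₂) + ‖k‖x₃) dk/((2π)²·2‖k‖)`,
harmonic in the half-space `x₃ < 0`. -/
def lowerHarmonic (p : E2 → ℂ) : E3 → ℂ := fun x =>
  ∫ k : E2, p k * Complex.exp (Complex.I * ((k 0 * x 0 + k 1 * x 1 : ℝ) : ℂ)
      + ((‖k‖ * x 2 : ℝ) : ℂ)) / (((2 * π) ^ 2 * (2 * ‖k‖) : ℝ) : ℂ)

/-- `g(x) = ∫_{ℝ²} q(k) exp(i(k₁x₁+k₂x₂) - ‖k‖x₃) dk/((2π)²·2‖k‖)`,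
harmonic in the half-space `x₃ > 0`. -/
def upperHarmonic (q : E2 → ℂ) : E3 → ℂ := fun x =>
  ∫ k : E2, q k * Complex.exp (Complex.I * ((k 0 * x 0 + k 1 * x 1 : ℝ) : ℂ)
      - ((‖k‖ * x 2 : ℝ) : ℂ)) / (((2 * π) ^ 2 * (2 * ‖k‖) : ℝ) : ℂ)

open scoped FourierTransform SchwartzMap ContDiff Topology

/-- The linear phase `x ↦ i(k₁x₁ + k₂x₂) + s‖k‖x₃` on `ℝ³`. -/
def phase (s : ℝ) (k : E2) : E3 →L[ℝ] ℂ :=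
  (Complex.I * (k 0 : ℂ)) • (Complex.ofRealCLM ∘L EuclideanSpace.proj (0 : Fin 3))
    + (Complex.I * (k 1 : ℂ)) • (Complex.ofRealCLM ∘L EuclideanSpace.proj (1 : Fin 3))
    + ((s * ‖k‖ : ℝ) : ℂ) • (Complex.ofRealCLM ∘L EuclideanSpace.proj (2 : Fin 3))

theorem phase_apply (s : ℝ) (k : E2) (x : E3) :
    phase s k x = Complex.I * ((k 0 * x 0 + k 1 * x 1 : ℝ) : ℂ) + ((s * ‖k‖ * x 2 : ℝ) : ℂ) := by
  simp [phase]
  ring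

theorem phase_mk3_zero (s : ℝ) (k y : E2) :
    phase s k (mk3 (y 0) (y 1) 0) = Complex.I * (inner ℝ k y : ℝ) := by
  simp [phase_apply, mk3, PiLp.inner_apply, Fin.sum_univ_two]
  ring

theorem phase_single_two (s : ℝ) (k : E2) :
    phase s k (EuclideanSpace.single 2 1) = ((s * ‖k‖ : ℝ) : ℂ) := by
  simp [phase_apply]

theorem continuous_phase (s : ℝ) : Continuous (phase s) := by
  unfold phase
  fun_prop

/-- The superposition of the harmonic exponentials `exp (phase s k x)` with amplitude `a`. -/
def modeIntegral (s : ℝ) (a : E2 → ℂ) (x : E3) : ℂ :=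
  ∫ k : E2, a k * Complex.exp (phase s k x)

theorem hasFDerivAt_modeIntegral (s : ℝ) {a : E2 → ℂ} (ha : Continuous a)
    (hac : HasCompactSupport a) (x : E3) :
    HasFDerivAt (modeIntegral s a)
      (∫ k : E2, (a k * Complex.exp (phase s k x)) • phase s k) x := by
  have hph := continuous_phase s
  have hcont (y : E3) : Continuous fun k => a k * Complex.exp (phase s k y) := by fun_prop
  refine hasFDerivAt_integral_of_dominated_of_fderiv_le
    (F := fun y k => a k * Complex.exp (phase s k y))
    (F' := fun y k => (a k * Complex.exp (phase s k y)) • phase s k)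
    (bound := fun k => ‖a k‖ * (Real.exp (‖phase s k‖ * (‖x‖ + 1)) * ‖phase s k‖))
    (Metric.ball_mem_nhds x one_pos) ?_ ?_ ?_ ?_ ?_ ?_
  · exact Filter.Eventually.of_forall fun y => (hcont y).aestronglyMeasurable
  · exact (hcont x).integrable_of_hasCompactSupport hac.mul_right
  · exact ((hcont x).smul hph).aestronglyMeasurable
  · refine Filter.Eventually.of_forall fun k y hy => ?_
    have hy' : ‖y‖ ≤ ‖x‖ + 1 := by
      have h1 := norm_le_norm_add_norm_sub' y x
      have h2 := mem_ball_iff_norm.1 hy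
      linarith
    rw [norm_smul, norm_mul, mul_assoc]
    gcongr
    rw [Complex.norm_exp]
    gcongr
    calc (phase s k y).re ≤ ‖phase s k y‖ := Complex.re_le_norm _
      _ ≤ ‖phase s k‖ * ‖y‖ := (phase s k).le_opNorm y
      _ ≤ _ := by gcongr
  · refine Continuous.integrable_of_hasCompactSupport (by fun_prop) ?_
    exact hac.norm.mul_right
  · refine Filter.Eventually.of_forall fun k y _ => ?_
    have h := ((phase s k).hasFDerivAt (x := y)).cexp.const_mul (a k)
    rwa [smul_smul] at h

theorem pd_two_modeIntegral (s : ℝ) {a : E2 → ℂ} (ha : Continuous a)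
    (hac : HasCompactSupport a) (x : E3) :
    pd 2 (modeIntegral s a) x = modeIntegral s (fun k => a k * ((s * ‖k‖ : ℝ) : ℂ)) x := by
  have hph := continuous_phase s
  have hint : Integrable fun k => (a k * Complex.exp (phase s k x)) • phase s k := by
    refine Continuous.integrable_of_hasCompactSupport (by fun_prop) (hac.mono fun k hk => ?_)
    contrapose! hk
    rw [Function.notMem_support] at hk ⊢
    ext v
    simp [hk]
  rw [pd, (hasFDerivAt_modeIntegral s ha hac x).fderiv, ContinuousLinearMap.integral_apply hint]
  refine integral_congr_ae (Filter.Eventually.of_forall fun k => ?_)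
  simp only [smul_apply, phase_single_two, smul_eq_mul]
  ring

theorem modeIntegral_mk3_zero (s : ℝ) (a : 𝓢(E2, ℂ)) (y : E2) :
    modeIntegral s a (mk3 (y 0) (y 1) 0) = 𝓕⁻ a ((2 * π)⁻¹ • y) := by
  rw [SchwartzMap.fourierInv_coe, Real.fourierInv_eq', modeIntegral]
  refine integral_congr_ae (Filter.Eventually.of_forall fun k => ?_)
  have h : 2 * π * inner ℝ k ((2 * π)⁻¹ • y) = inner ℝ k y := by
    rw [inner_smul_right, mul_inv_cancel_left₀ (by positivity)]
  simp only [phase_mk3_zero, h, smul_eq_mul]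
  rw [mul_comm, mul_comm Complex.I]

theorem integrable_mul_fourierInv (a b : 𝓢(E2, ℂ)) :
    Integrable fun y : E2 => 𝓕⁻ a ((2 * π)⁻¹ • y) * 𝓕⁻ b ((2 * π)⁻¹ • y) := by
  have h : Integrable fun y : E2 => 𝓕⁻ a y * 𝓕⁻ b y :=
    (𝓕⁻ b).integrable.bdd_mul (𝓕⁻ a).continuous.aestronglyMeasurable
      (Filter.Eventually.of_forall fun y => (𝓕⁻ a).norm_le_seminorm ℝ y)
  exact h.comp_smul (by positivity)

theorem integral_mul_fourierInv (a b : 𝓢(E2, ℂ)) :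
    ∫ y : E2, 𝓕⁻ a ((2 * π)⁻¹ • y) * 𝓕⁻ b ((2 * π)⁻¹ • y)
      = (((2 * π) ^ 2 : ℝ) : ℂ) * ∫ k : E2, a k * b (-k) := by
  rw [Measure.integral_comp_inv_smul volume (fun y => 𝓕⁻ a y * 𝓕⁻ b y),
    SchwartzMap.integral_fourierInv_mul_eq, finrank_euclideanSpace_fin, abs_of_nonneg (by positivity),
    Complex.real_smul]
  congr 2
  ext k
  have h : 𝓕⁻ (𝓕⁻ b) k = 𝓕 (𝓕⁻ b) (-k) := by
    rw [SchwartzMap.fourierInv_coe (𝓕⁻ b), Real.fourierInv_eq_fourier_neg, SchwartzMap.fourier_coe]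
  rw [h, FourierTransform.fourier_fourierInv_eq]

/-- The amplitude of the harmonic function determined by the Fourier mode `p`. -/
def amplitude (p : E2 → ℂ) (k : E2) : ℂ :=
  p k / (((2 * π) ^ 2 * (2 * ‖k‖) : ℝ) : ℂ)

theorem contDiff_amplitude {p : E2 → ℂ} (hp : ContDiff ℝ ∞ p) (hp0 : (0 : E2) ∉ tsupport p) :
    ContDiff ℝ ∞ (amplitude p) := by
  rw [contDiff_iff_contDiffAt]
  intro k
  by_cases hk : k = 0
  · subst hk
    have h0 : amplitude p =ᶠ[𝓝 0] fun _ => 0 := by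
      filter_upwards [notMem_tsupport_iff_eventuallyEq.1 hp0] with k hk
      simp [amplitude, hk]
    exact contDiffAt_const.congr_of_eventuallyEq h0
  · have hn : ContDiffAt ℝ ∞ (fun k : E2 => (((2 * π) ^ 2 * (2 * ‖k‖) : ℝ) : ℂ)) k :=
      Complex.ofRealCLM.contDiff.contDiffAt.comp k
        (contDiffAt_const.mul (contDiffAt_const.mul (contDiffAt_norm ℝ hk)))
    refine (hp.contDiffAt.mul (hn.inv ?_)).congr_of_eventuallyEq
      (Filter.Eventually.of_forall fun _ => div_eq_mul_inv _ _)
    have : 0 < ‖k‖ := norm_pos_iff.2 hk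
    exact Complex.ofReal_ne_zero.2 (by positivity)

theorem hasCompactSupport_amplitude {p : E2 → ℂ} (hpc : HasCompactSupport p) :
    HasCompactSupport (amplitude p) := by
  unfold amplitude
  simp_rw [div_eq_mul_inv]
  exact hpc.mul_right

theorem amplitude_mul_norm {p : E2 → ℂ} (hp0 : (0 : E2) ∉ tsupport p) (s : ℝ) (k : E2) :
    amplitude p k * ((s * ‖k‖ : ℝ) : ℂ) = p k * ((s * (2 * (2 * π) ^ 2)⁻¹ : ℝ) : ℂ) := by
  by_cases hk : k = 0
  · subst hk
    simp [image_eq_zero_of_notMem_tsupport hp0]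
  · have : (‖k‖ : ℂ) ≠ 0 := Complex.ofReal_ne_zero.2 (norm_ne_zero_iff.2 hk)
    have hpi : (π : ℂ) ≠ 0 := Complex.ofReal_ne_zero.2 pi_ne_zero
    simp only [amplitude]
    push_cast
    field_simp

theorem lowerHarmonic_eq_modeIntegral (p : E2 → ℂ) :
    lowerHarmonic p = modeIntegral 1 (amplitude p) := by
  ext x
  simp only [lowerHarmonic, modeIntegral, amplitude, phase_apply, one_mul, div_mul_eq_mul_div]

theorem upperHarmonic_eq_modeIntegral (q : E2 → ℂ) :
    upperHarmonic q = modeIntegral (-1) (amplitude q) := by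
  ext x
  simp only [upperHarmonic, modeIntegral, amplitude, phase_apply, neg_mul, one_mul,
    Complex.ofReal_neg, ← sub_eq_add_neg, div_mul_eq_mul_div]

/-- Boundary values and normal derivative on `x₃ = 0` as rescaled inverse Fourier transforms. -/
theorem exists_schwartzMap_boundary {p : E2 → ℂ} (hp : ContDiff ℝ ∞ p)
    (hpc : HasCompactSupport p) (hp0 : (0 : E2) ∉ tsupport p) (s : ℝ) :
    ∃ a b : 𝓢(E2, ℂ), (∀ k, a k = amplitude p k) ∧
      (∀ k, b k = p k * ((s * (2 * (2 * π) ^ 2)⁻¹ : ℝ) : ℂ)) ∧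
      ∀ y : E2,
        modeIntegral s (amplitude p) (mk3 (y 0) (y 1) 0) = 𝓕⁻ a ((2 * π)⁻¹ • y) ∧
        pd 2 (modeIntegral s (amplitude p)) (mk3 (y 0) (y 1) 0) = 𝓕⁻ b ((2 * π)⁻¹ • y) := by
  have ha := contDiff_amplitude hp hp0
  have hac := hasCompactSupport_amplitude hpc
  have hb : ContDiff ℝ ∞ fun k => p k * ((s * (2 * (2 * π) ^ 2)⁻¹ : ℝ) : ℂ) :=
    hp.mul contDiff_const
  have hbc : HasCompactSupport fun k => p k * ((s * (2 * (2 * π) ^ 2)⁻¹ : ℝ) : ℂ) :=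
    hpc.mul_right
  refine ⟨hac.toSchwartzMap ha, hbc.toSchwartzMap hb, fun k => rfl, fun k => rfl, fun y => ⟨?_, ?_⟩⟩
  · exact modeIntegral_mk3_zero s (hac.toSchwartzMap ha) y
  · rw [pd_two_modeIntegral s ha.continuous hac]
    simp_rw [amplitude_mul_norm hp0]
    exact modeIntegral_mk3_zero s (hbc.toSchwartzMap hb) y

/-- The pairing `⟨f,g⟩ = ∫_{x₃=0} (g ∂₃f - f ∂₃g)` of the harmonic functions
determined by Fourier modes `p` and `q` equals
`∫_{ℝ²} p(k) q(-k) dk/((2π)²·2‖k‖)`. -/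
theorem harmonic_pairing_in_fourier_modes
    (p q : E2 → ℂ) (hp : ContDiff ℝ (⊤ : ℕ∞) p) (hq : ContDiff ℝ (⊤ : ℕ∞) q)
    (hpc : HasCompactSupport p) (hqc : HasCompactSupport q)
    (hp0 : (0 : E2) ∉ tsupport p) (hq0 : (0 : E2) ∉ tsupport q) :
    Integrable (fun y : E2 =>
      upperHarmonic q (mk3 (y 0) (y 1) 0) * pd 2 (lowerHarmonic p) (mk3 (y 0) (y 1) 0)
        - lowerHarmonic p (mk3 (y 0) (y 1) 0) *
            pd 2 (upperHarmonic q) (mk3 (y 0) (y 1) 0)) ∧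
    ∫ y : E2,
        (upperHarmonic q (mk3 (y 0) (y 1) 0) * pd 2 (lowerHarmonic p) (mk3 (y 0) (y 1) 0)
          - lowerHarmonic p (mk3 (y 0) (y 1) 0) *
              pd 2 (upperHarmonic q) (mk3 (y 0) (y 1) 0))
      = ∫ k : E2, p k * q (-k) / (((2 * π) ^ 2 * (2 * ‖k‖) : ℝ) : ℂ) := by
  obtain ⟨a, a', ha, ha', hA⟩ := exists_schwartzMap_boundary hp hpc hp0 1
  obtain ⟨b, b', hb, hb', hB⟩ := exists_schwartzMap_boundary hq hqc hq0 (-1)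
  simp only [lowerHarmonic_eq_modeIntegral, upperHarmonic_eq_modeIntegral, fun y => (hA y).1,
    fun y => (hA y).2, fun y => (hB y).1, fun y => (hB y).2]
  simp_rw [mul_comm (𝓕⁻ b _)]
  have h₁ := integrable_mul_fourierInv a' b
  have h₂ := integrable_mul_fourierInv a b'
  refine ⟨h₁.sub h₂, ?_⟩
  have hneg : Integrable fun k => a' k * b (-k) :=
    (b.integrable.comp_neg).bdd_mul a'.continuous.aestronglyMeasurable
      (Filter.Eventually.of_forall fun k => a'.norm_le_seminorm ℝ k)
  have hneg' : Integrable fun k => a k * b' (-k) :=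
    (b'.integrable.comp_neg).bdd_mul a.continuous.aestronglyMeasurable
      (Filter.Eventually.of_forall fun k => a.norm_le_seminorm ℝ k)
  rw [integral_sub h₁ h₂, integral_mul_fourierInv, integral_mul_fourierInv, ← mul_sub,
    ← integral_sub hneg hneg', ← integral_const_mul]
  refine integral_congr_ae (Filter.Eventually.of_forall fun k => ?_)
  have hpi : (π : ℂ) ≠ 0 := Complex.ofReal_ne_zero.2 pi_ne_zero
  simp only [ha, ha', hb, hb', amplitude, norm_neg]
  push_cast
  field_simp
  ring
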